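/- arXiv:2511.16377 — 6 statements merged into one kernel-verified Lean document; each statement's English description precedes it below -/
import Mathlib

section
/- Let (A, Y) be a pair of random variables on a probability space, where A takes values in {1, …, k} and Y takes values in {0, 1}, with Pr(A = a) > 0 for every a. Fix ε ≥ 0 and let Z be the output of the generalized randomized response mechanism applied to A, i.e. Z is conditionally independent of Y given A with Pr(Z = z | A = a) = e^ε/(e^ε + k − 1) if z = a and 1/(e^ε + k − 1) if z ≠ a. Then max_{z, z' ∈ {1,…,k}} |Pr(Y = 1 | Z = z) − Pr(Y = 1 | Z = z')| ≤ max_{a, a' ∈ {1,…,k}} |Pr(Y = 1 | A = a) − Pr(Y = 1 | A = a')|. -/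
open MeasureTheory

/-- Conditional probability `Pr(s | t)` as a real number. -/
noncomputable def condProb {Ω : Type*} [MeasurableSpace Ω] (μ : Measure Ω)
    (s t : Set Ω) : ℝ := (μ (s ∩ t)).toReal / (μ t).toReal

/-- Law of total probability along a random variable with finitely many values. -/
theorem measureReal_eq_sum_inter_fiber {Ω ι : Type*} [MeasurableSpace Ω] [Fintype ι]
    [MeasurableSpace ι] [MeasurableSingletonClass ι] (μ : Measure Ω) [IsFiniteMeasure μ]
    {f : Ω → ι} (hf : Measurable f) (s : Set Ω) :
    μ.real s = ∑ a, μ.real (s ∩ {ω | f ω = a}) := by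
  have hm : ∀ a, MeasurableSet {ω | f ω = a} := fun a => hf (measurableSet_singleton a)
  have h := sum_measureReal_preimage_singleton (μ := μ.restrict s) Finset.univ (f := f)
    (fun a _ => hm a)
  rw [Finset.coe_univ, Set.preimage_univ, measureReal_restrict_apply_univ] at h
  rw [← h]
  refine Finset.sum_congr rfl fun a _ => ?_
  rw [measureReal_restrict_apply (hf (measurableSet_singleton a)), Set.inter_comm]
  rfl

/-- The spread of weighted averages of `p` is at most the spread of `p`. -/
theorem iSup_abs_sub_weighted_average_le {ι κ : Type*} [Fintype ι] [Nonempty ι] [Nonempty κ]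
    (p : ι → ℝ) (q : κ → ℝ) (w : κ → ι → ℝ) (hw : ∀ z a, 0 < w z a)
    (hq : ∀ z, q z = (∑ a, w z a * p a) / ∑ a, w z a) :
    (⨆ z, ⨆ z', |q z - q z'|) ≤ ⨆ a, ⨆ a', |p a - p a'| := by
  obtain ⟨i, hi⟩ := Finite.exists_min p
  obtain ⟨j, hj⟩ := Finite.exists_max p
  have hD : ∀ z, 0 < ∑ a, w z a := fun z =>
    Finset.sum_pos (fun a _ => hw z a) Finset.univ_nonempty
  have hlow : ∀ z, p i ≤ q z := fun z => by
    rw [hq, le_div_iff₀ (hD z), Finset.mul_sum]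
    refine Finset.sum_le_sum fun a _ => ?_
    rw [mul_comm]
    exact mul_le_mul_of_nonneg_left (hi a) (hw z a).le
  have hup : ∀ z, q z ≤ p j := fun z => by
    rw [hq, div_le_iff₀ (hD z), Finset.mul_sum]
    refine Finset.sum_le_sum fun a _ => ?_
    rw [mul_comm (p j)]
    exact mul_le_mul_of_nonneg_left (hj a) (hw z a).le
  have hspread : p j - p i ≤ ⨆ a, ⨆ a', |p a - p a'| :=
    (le_abs_self _).trans <|
      (le_ciSup (f := fun a' => |p j - p a'|) (Set.finite_range _).bddAbove i).trans
        (le_ciSup (f := fun a => ⨆ a', |p a - p a'|) (Set.finite_range _).bddAbove j)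
  refine ciSup_le fun z => ciSup_le fun z' => le_trans ?_ hspread
  rw [abs_le]
  constructor <;> linarith [hlow z, hlow z', hup z, hup z']

/-- Lemma 1: applying the generalized randomized response mechanism (with privacy
parameter `ε ≥ 0`) to the sensitive attribute `A ∈ {1,…,k}` never increases the data
unfairness `Δ' = max_{a,a'} |Pr(Y = 1 | A = a) − Pr(Y = 1 | A = a')|`. -/
theorem grr_reduces_data_unfairness
    {Ω : Type*} [MeasurableSpace Ω] (μ : Measure Ω) [IsProbabilityMeasure μ]
    (k : ℕ) (hk : 0 < k)
    (A Z : Ω → Fin k) (Y : Ω → Bool)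
    (hA : Measurable A) (hZ : Measurable Z) (hY : Measurable Y)
    (hApos : ∀ a : Fin k, 0 < (μ {ω | A ω = a}).toReal)
    (ε : ℝ) (hε : 0 ≤ ε)
    (hGRR : ∀ (z a : Fin k) (y : Bool),
      (μ {ω | Z ω = z ∧ A ω = a ∧ Y ω = y}).toReal
        = (if z = a then Real.exp ε / (Real.exp ε + (k : ℝ) - 1)
            else 1 / (Real.exp ε + (k : ℝ) - 1)) *
          (μ {ω | A ω = a ∧ Y ω = y}).toReal) :
    (⨆ z : Fin k, ⨆ z' : Fin k,
        |condProb μ {ω | Y ω = true} {ω | Z ω = z}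
          - condProb μ {ω | Y ω = true} {ω | Z ω = z'}|)
      ≤ ⨆ a : Fin k, ⨆ a' : Fin k,
        |condProb μ {ω | Y ω = true} {ω | A ω = a}
          - condProb μ {ω | Y ω = true} {ω | A ω = a'}| := by
  have : Nonempty (Fin k) := ⟨⟨0, hk⟩⟩
  have hk1 : (1 : ℝ) ≤ k := by exact_mod_cast hk
  have hden : 0 < Real.exp ε + (k : ℝ) - 1 := by linarith [Real.exp_pos ε]
  set c : Fin k → Fin k → ℝ := fun z a =>
    if z = a then Real.exp ε / (Real.exp ε + (k : ℝ) - 1)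
      else 1 / (Real.exp ε + (k : ℝ) - 1) with hc
  have hcpos : ∀ z a, 0 < c z a := fun z a => by
    simp only [hc]
    split_ifs <;> positivity
  have hjoint : ∀ z a y, μ.real {ω | Z ω = z ∧ A ω = a ∧ Y ω = y}
      = c z a * μ.real {ω | A ω = a ∧ Y ω = y} := hGRR
  have hpair : ∀ z a, μ.real ({ω | Z ω = z} ∩ {ω | A ω = a})
      = c z a * μ.real {ω | A ω = a} := fun z a => by
    rw [measureReal_eq_sum_inter_fiber μ hY ({ω | Z ω = z} ∩ {ω | A ω = a}),
      measureReal_eq_sum_inter_fiber μ hY {ω | A ω = a}, Finset.mul_sum]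
    refine Finset.sum_congr rfl fun y _ => ?_
    rw [Set.inter_assoc]
    exact hjoint z a y
  refine iSup_abs_sub_weighted_average_le _ _ (fun z a => c z a * μ.real {ω | A ω = a})
    (fun z a => mul_pos (hcpos z a) (hApos a)) fun z => ?_
  change μ.real _ / μ.real _ = _
  rw [measureReal_eq_sum_inter_fiber μ hA {ω | Z ω = z},
    measureReal_eq_sum_inter_fiber μ hA ({ω | Y ω = true} ∩ {ω | Z ω = z})]
  simp only [hpair]
  congr 1
  refine Finset.sum_congr rfl fun a _ => ?_
  have hset : {ω | Y ω = true} ∩ {ω | Z ω = z} ∩ {ω | A ω = a}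
      = {ω | Z ω = z ∧ A ω = a ∧ Y ω = true} := by
    ext ω
    simp only [Set.mem_inter_iff, Set.mem_ofPred_eq]
    tauto
  have hset' : {ω | Y ω = true} ∩ {ω | A ω = a} = {ω | A ω = a ∧ Y ω = true} :=
    Set.inter_comm _ _
  have hne : μ.real {ω | A ω = a} ≠ 0 := (hApos a).ne'
  have hcond : condProb μ {ω | Y ω = true} {ω | A ω = a}
      = μ.real {ω | A ω = a ∧ Y ω = true} / μ.real {ω | A ω = a} := by
    rw [← hset']
    rfl
  rw [hset, hjoint, hcond, mul_assoc, mul_div_cancel₀ _ hne]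
end

section
/- Let (A, Y) be a pair of random variables on a probability space, where A takes values in {1, …, k} and Y takes values in {0, 1}, with Pr(A = a) > 0 for every a and Pr(Y = 1) > 0. Define Δ = max_{a ∈ {1,…,k}} |Pr(Y = 1 | A = a)/Pr(Y = 1) − 1| and Δ' = max_{a, a' ∈ {1,…,k}} |Pr(Y = 1 | A = a) − Pr(Y = 1 | A = a')|. Then Δ ≤ (1/Pr(Y = 1)) · Δ'. -/
open MeasureTheory

theorem sum_measureReal_inter_fiber {Ω ι : Type*} [MeasurableSpace Ω] [Fintype ι]
    [MeasurableSpace ι] [MeasurableSingletonClass ι] (μ : Measure Ω) [IsFiniteMeasure μ]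
    {A : Ω → ι} (hA : Measurable A) (s : Set Ω) :
    ∑ a, (μ (s ∩ {ω | A ω = a})).toReal = (μ s).toReal := by
  have h := sum_measureReal_preimage_singleton (μ := μ.restrict s) (f := A) Finset.univ
    fun a _ => hA (measurableSet_singleton a)
  simp only [Finset.coe_univ, Set.preimage_univ, measureReal_restrict_apply_univ] at h
  rw [← measureReal_def, ← h]
  refine Finset.sum_congr rfl fun a _ => ?_
  rw [measureReal_restrict_apply (hA (measurableSet_singleton a)), Set.inter_comm]
  rfl

/-- The law of total probability over the fibers of a random variable with finitely many values. -/
theorem sum_measure_fiber_mul_condProb {Ω ι : Type*} [MeasurableSpace Ω] [Fintype ι]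
    [MeasurableSpace ι] [MeasurableSingletonClass ι] (μ : Measure Ω) [IsFiniteMeasure μ]
    {A : Ω → ι} (hA : Measurable A) (hApos : ∀ a, 0 < (μ {ω | A ω = a}).toReal) (s : Set Ω) :
    ∑ a, (μ {ω | A ω = a}).toReal * condProb μ s {ω | A ω = a} = (μ s).toReal := by
  rw [← sum_measureReal_inter_fiber μ hA s]
  exact Finset.sum_congr rfl fun a _ => mul_div_cancel₀ _ (hApos a).ne'

/-- If `Pr(s | A = a)` differs from every `Pr(s | A = a')` by at most `D`, then it differs from
their convex combination `Pr(s)` by at most `D`. -/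
theorem abs_condProb_sub_measure_le {Ω ι : Type*} [MeasurableSpace Ω] [Fintype ι]
    [MeasurableSpace ι] [MeasurableSingletonClass ι] (μ : Measure Ω) [IsProbabilityMeasure μ]
    {A : Ω → ι} (hA : Measurable A) (hApos : ∀ a, 0 < (μ {ω | A ω = a}).toReal) (s : Set Ω)
    {a : ι} {D : ℝ}
    (hD : ∀ a', |condProb μ s {ω | A ω = a} - condProb μ s {ω | A ω = a'}| ≤ D) :
    |condProb μ s {ω | A ω = a} - (μ s).toReal| ≤ D := by
  have hw : ∑ a', (μ {ω | A ω = a'}).toReal = 1 := by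
    simpa using sum_measureReal_inter_fiber μ hA Set.univ
  have hmem := (convex_closedBall (condProb μ s {ω | A ω = a}) D).sum_mem
    (t := Finset.univ) (z := fun a' => condProb μ s {ω | A ω = a'})
    (fun a' _ => (hApos a').le) hw
    fun a' _ => by simpa [Real.dist_eq, abs_sub_comm] using hD a'
  simpa [sum_measure_fiber_mul_condProb μ hA hApos s, Real.dist_eq, abs_sub_comm] using hmem

/-- First half of the appendix lemma: the data unfairness metric
`Δ = max_a |Pr(Y = 1 | A = a)/Pr(Y = 1) − 1|` is bounded by
`(1/Pr(Y = 1)) · Δ'` where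
`Δ' = max_{a,a'} |Pr(Y = 1 | A = a) − Pr(Y = 1 | A = a')|`. -/
theorem delta_le_deltaPrime
    {Ω : Type*} [MeasurableSpace Ω] (μ : Measure Ω) [IsProbabilityMeasure μ]
    (k : ℕ) (hk : 0 < k)
    (A : Ω → Fin k) (Y : Ω → Bool)
    (hA : Measurable A) (hY : Measurable Y)
    (hApos : ∀ a : Fin k, 0 < (μ {ω | A ω = a}).toReal)
    (hYpos : 0 < (μ {ω | Y ω = true}).toReal) :
    (⨆ a : Fin k,
        |condProb μ {ω | Y ω = true} {ω | A ω = a} / (μ {ω | Y ω = true}).toReal - 1|)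
      ≤ (1 / (μ {ω | Y ω = true}).toReal) *
        ⨆ a : Fin k, ⨆ a' : Fin k,
          |condProb μ {ω | Y ω = true} {ω | A ω = a}
            - condProb μ {ω | Y ω = true} {ω | A ω = a'}| := by
  have : Nonempty (Fin k) := ⟨⟨0, hk⟩⟩
  refine ciSup_le fun a => ?_
  rw [div_sub_one hYpos.ne', abs_div, abs_of_pos hYpos, div_eq_inv_mul, one_div]
  refine mul_le_mul_of_nonneg_left ?_ (inv_nonneg.2 hYpos.le)
  refine abs_condProb_sub_measure_le μ hA hApos _ fun a' => ?_
  exact (le_ciSup (Set.finite_range _).bddAbove a').trans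
    (le_ciSup (f := fun a => ⨆ a' : Fin k, |condProb μ {ω | Y ω = true} {ω | A ω = a}
      - condProb μ {ω | Y ω = true} {ω | A ω = a'}|) (Set.finite_range _).bddAbove a)
end

section
/- Let ε > 0 and let p_0, p_1 be real numbers with p_0 > 0, p_1 > 0, p_0 + p_1 = 1, and p_0 < p_1. Define F(p, q) = (pq − (1−p)(1−q)) / ((p_0(1−p) + p_1 q)(p_0 p + p_1(1−q))) and let S_ε = {(p, q) : 1/2 ≤ p ≤ 1, 1/2 ≤ q ≤ 1, p ≤ e^ε(1−q), q ≤ e^ε(1−p), and (p = e^ε(1−q) or q = e^ε(1−p))}. Then (1 − e^{−ε}/2, 1/2) ∈ S_ε and for every (p, q) ∈ S_ε, F(1 − e^{−ε}/2, 1/2) ≤ F(p, q). -/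
/-- The ratio `Δ'(D_M)/Δ'(D)` of perturbed to original data unfairness for the binary
mechanism with truthful-reporting probabilities `p` (for `A = 0`) and `q` (for `A = 1`),
where `p₀ = Pr(A = 0)` and `p₁ = Pr(A = 1)`. -/
noncomputable def F (p₀ p₁ p q : ℝ) : ℝ :=
  (p * q - (1 - p) * (1 - q)) /
    ((p₀ * (1 - p) + p₁ * q) * (p₀ * p + p₁ * (1 - q)))

/-- The parameter pairs of `ε`-LDP binary mechanisms with non-trivial utility whose
privacy level is exactly `ε` (at least one LDP constraint is tight). -/
def Sset (ε : ℝ) : Set (ℝ × ℝ) :=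
  {pq : ℝ × ℝ |
    1 / 2 ≤ pq.1 ∧ pq.1 ≤ 1 ∧ 1 / 2 ≤ pq.2 ∧ pq.2 ≤ 1 ∧
    pq.1 ≤ Real.exp ε * (1 - pq.2) ∧ pq.2 ≤ Real.exp ε * (1 - pq.1) ∧
    (pq.1 = Real.exp ε * (1 - pq.2) ∨ pq.2 = Real.exp ε * (1 - pq.1))}

/-- When the constraint on the output `Z = 1` is tight, the ratio is a function of `q` alone. -/
lemma F_one_sub_mul_left {p₀ p₁ q : ℝ} (t : ℝ) (hsum : p₀ + p₁ = 1) (hq : q ≠ 0) :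
    F p₀ p₁ (1 - t * q) q = (1 - t) / ((p₀ * t + p₁) * (1 - q * (p₀ * t + p₁))) := by
  obtain rfl : p₀ = 1 - p₁ := by linarith
  rw [F, ← mul_div_mul_left (1 - t) _ hq]
  congr 1 <;> ring

lemma F_swap (p₀ p₁ p q : ℝ) : F p₀ p₁ p q = F p₁ p₀ q p := by
  unfold F
  congr 1 <;> ring

/-- When the constraint on the output `Z = 0` is tight, the ratio is a function of `p` alone. -/
lemma F_one_sub_mul_right {p₀ p₁ p : ℝ} (t : ℝ) (hsum : p₀ + p₁ = 1) (hp : p ≠ 0) :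
    F p₀ p₁ p (1 - t * p) = (1 - t) / ((p₁ * t + p₀) * (1 - p * (p₁ * t + p₀))) := by
  rw [F_swap, F_one_sub_mul_left t (by linarith) hp]

lemma div_mul_one_sub_half_le {a c d r : ℝ} (ha : 0 ≤ a) (hd : 0 < d) (hdc : d ≤ c)
    (hc : c ≤ 1) (hr : 1 / 2 ≤ r) (hrd : r * d < 1) :
    a / (c * (1 - 1 / 2 * c)) ≤ a / (d * (1 - r * d)) := by
  apply div_le_div_of_nonneg_left ha (mul_pos hd (by linarith))
  have h : 1 / 2 * d ≤ r * d := by gcongr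
  calc d * (1 - r * d) ≤ d * (1 - 1 / 2 * d) := by gcongr
    _ ≤ c * (1 - 1 / 2 * c) := by
      nlinarith [mul_nonneg (sub_nonneg.2 hdc) (show 0 ≤ 2 - c - d by linarith)]

/-- Theorem 1 (case `p₀ < p₁`): the optimal `ε`-LDP mechanism minimizing the data
unfairness ratio is `(p*, q*) = (1 − e^{−ε}/2, 1/2)`. -/
theorem optimal_binary_mechanism_p0_lt_p1
    (ε p₀ p₁ : ℝ) (hε : 0 < ε)
    (h₀ : 0 < p₀) (h₁ : 0 < p₁) (hsum : p₀ + p₁ = 1) (hlt : p₀ < p₁) :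
    (1 - Real.exp (-ε) / 2, 1 / 2) ∈ Sset ε ∧
    ∀ pq ∈ Sset ε, F p₀ p₁ (1 - Real.exp (-ε) / 2) (1 / 2) ≤ F p₀ p₁ pq.1 pq.2 := by
  have ht : 0 < Real.exp (-ε) := Real.exp_pos _
  have ht1 : Real.exp (-ε) < 1 := by simpa using hε
  have hk : Real.exp (-ε) * Real.exp ε = 1 := by rw [← Real.exp_add]; simp
  have hk1 : 1 < Real.exp ε := Real.one_lt_exp_iff.2 hε
  have hopt : F p₀ p₁ (1 - Real.exp (-ε) / 2) (1 / 2) =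
      (1 - Real.exp (-ε)) /
        ((p₀ * Real.exp (-ε) + p₁) * (1 - 1 / 2 * (p₀ * Real.exp (-ε) + p₁))) := by
    simpa only [mul_one_div] using
      F_one_sub_mul_left (q := 1 / 2) (Real.exp (-ε)) hsum (by norm_num)
  unfold Sset
  generalize Real.exp (-ε) = t at *
  generalize Real.exp ε = k at *
  refine ⟨⟨by linarith, by linarith, le_rfl, by norm_num, ?_, by linarith, Or.inr (by linarith)⟩, ?_⟩
  · change 1 - t / 2 ≤ k * (1 - 1 / 2)
    nlinarith [mul_nonneg (sub_nonneg.2 hk1.le) (sub_nonneg.2 ht1.le)]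
  rintro ⟨p, q⟩ ⟨hp, hp1, hq, hq1, -, -, h⟩
  dsimp only at *
  rw [hopt]
  rcases h with h | h
  · obtain rfl : q = 1 - t * p := by rw [h]; linear_combination (1 - q) * hk
    rw [F_one_sub_mul_right t hsum (by linarith)]
    apply div_mul_one_sub_half_le <;> nlinarith [mul_pos h₀ ht, mul_pos h₁ ht]
  · obtain rfl : p = 1 - t * q := by rw [h]; linear_combination (1 - p) * hk
    rw [F_one_sub_mul_left t hsum (by linarith)]
    apply div_mul_one_sub_half_le <;> nlinarith [mul_pos h₀ ht, mul_pos h₁ ht]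
end

section
/- Let p_0, p_1, r_0, r_1, p, q be real numbers with p_0 > 0, p_1 > 0, r_0 ≤ r_1, 1/2 ≤ p ≤ 1, and 1/2 ≤ q ≤ 1. Then (r_0·p_0·p + r_1·p_1·(1−q)) / (p_0·p + p_1·(1−q)) ≤ (r_0·p_0·(1−p) + r_1·p_1·q) / (p_0·(1−p) + p_1·q). -/
/-- Step 2 of the proof of Theorem 1: when `r₀ ≤ r₁` and `p, q ∈ [1/2, 1]`, the
posterior of `Y = 1` given `Z = 0` is at most the posterior given `Z = 1`. -/
theorem posterior_monotone
    (p₀ p₁ r₀ r₁ p q : ℝ)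
    (h₀ : 0 < p₀) (h₁ : 0 < p₁) (hr : r₀ ≤ r₁)
    (hp : 1 / 2 ≤ p) (hp' : p ≤ 1) (hq : 1 / 2 ≤ q) (hq' : q ≤ 1) :
    (r₀ * p₀ * p + r₁ * p₁ * (1 - q)) / (p₀ * p + p₁ * (1 - q))
      ≤ (r₀ * p₀ * (1 - p) + r₁ * p₁ * q) / (p₀ * (1 - p) + p₁ * q) := by
  have hd₀ : 0 < p₀ * p + p₁ * (1 - q) :=
    add_pos_of_pos_of_nonneg (mul_pos h₀ (by linarith)) (mul_nonneg h₁.le (by linarith))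
  have hd₁ : 0 < p₀ * (1 - p) + p₁ * q :=
    add_pos_of_nonneg_of_pos (mul_nonneg h₀.le (by linarith)) (mul_pos h₁ (by linarith))
  rw [div_le_div_iff₀ hd₀ hd₁]
  have key : 0 ≤ (r₁ - r₀) * (p₀ * p₁) * (p + q - 1) :=
    mul_nonneg (mul_nonneg (by linarith) (mul_pos h₀ h₁).le) (by linarith)
  linarith
end

section
/- Let ε > 0 and let p_0, p_1 be real numbers with p_0 > 0, p_1 > 0, p_0 + p_1 = 1. Define F(p, q) = (pq − (1−p)(1−q)) / ((p_0(1−p) + p_1 q)(p_0 p + p_1(1−q))). Then for every q with e^ε/(e^ε+1) ≤ q ≤ 1 − e^{−ε}/2, setting p = e^ε(1−q), one has F(e^ε(1−q), q) = (e^ε − 1) / ((p_0(1 − e^ε(1−q)) + p_1 q)·(p_0 e^ε + p_1)); moreover this expression is a nonincreasing function of q on that interval, so it is minimized at q = 1 − e^{−ε}/2. -/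
/-- On the line `p = c (1 - q)` a factor `1 - q` cancels from `F`. -/
theorem F_mul_one_sub (p₀ p₁ c : ℝ) {q : ℝ} (hq : q < 1) :
    F p₀ p₁ (c * (1 - q)) q =
      (c - 1) / ((p₀ * (1 - c * (1 - q)) + p₁ * q) * (p₀ * c + p₁)) := by
  have hq' : 1 - q ≠ 0 := (sub_pos.2 hq).ne'
  rw [F, show c * (1 - q) * q - (1 - c * (1 - q)) * (1 - q) = (c - 1) * (1 - q) by ring,
    show (p₀ * (1 - c * (1 - q)) + p₁ * q) * (p₀ * (c * (1 - q)) + p₁ * (1 - q)) =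
      (p₀ * (1 - c * (1 - q)) + p₁ * q) * (p₀ * c + p₁) * (1 - q) by ring,
    mul_div_mul_right _ _ hq']

theorem F_mul_one_sub_antitone {p₀ p₁ c q q' : ℝ} (h₀ : 0 < p₀) (h₁ : 0 < p₁) (hc : 1 ≤ c)
    (hq : c / (c + 1) ≤ q) (hqq' : q ≤ q') (hq' : q' < 1) :
    F p₀ p₁ (c * (1 - q')) q' ≤ F p₀ p₁ (c * (1 - q)) q := by
  have hc₀ : 0 < c := one_pos.trans_le hc
  have hq₀ : 0 < q := lt_of_lt_of_le (by positivity) hq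
  have hpq : 0 < 1 - c * (1 - q) := by
    have := (div_le_iff₀ (by positivity)).1 hq
    linarith
  have hmono : c * (1 - q') ≤ c * (1 - q) := by gcongr
  rw [F_mul_one_sub p₀ p₁ c hq', F_mul_one_sub p₀ p₁ c (hqq'.trans_lt hq')]
  have hc₁ : 0 ≤ c - 1 := sub_nonneg.2 hc
  gcongr

/-- Case 1 computation in the proof of Theorem 1: on the boundary piece
`p = e^ε(1−q)` with `q ∈ [e^ε/(e^ε+1), 1 − e^{−ε}/2]`, the objective simplifies to
`(e^ε − 1)/((p₀(1 − e^ε(1−q)) + p₁ q)(p₀ e^ε + p₁))`, this expression is nonincreasing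
in `q` on the interval, and hence it is minimized at `q = 1 − e^{−ε}/2`. -/
theorem case1_boundary_minimization
    (ε p₀ p₁ : ℝ) (hε : 0 < ε)
    (h₀ : 0 < p₀) (h₁ : 0 < p₁) (hsum : p₀ + p₁ = 1) :
    (∀ q : ℝ, Real.exp ε / (Real.exp ε + 1) ≤ q → q ≤ 1 - Real.exp (-ε) / 2 →
      F p₀ p₁ (Real.exp ε * (1 - q)) q
        = (Real.exp ε - 1) /
            ((p₀ * (1 - Real.exp ε * (1 - q)) + p₁ * q) * (p₀ * Real.exp ε + p₁))) ∧
    (∀ q q' : ℝ, Real.exp ε / (Real.exp ε + 1) ≤ q → q ≤ 1 - Real.exp (-ε) / 2 →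
      Real.exp ε / (Real.exp ε + 1) ≤ q' → q' ≤ 1 - Real.exp (-ε) / 2 →
      q ≤ q' →
      F p₀ p₁ (Real.exp ε * (1 - q')) q' ≤ F p₀ p₁ (Real.exp ε * (1 - q)) q) ∧
    (∀ q : ℝ, Real.exp ε / (Real.exp ε + 1) ≤ q → q ≤ 1 - Real.exp (-ε) / 2 →
      F p₀ p₁ (Real.exp ε * (1 - (1 - Real.exp (-ε) / 2))) (1 - Real.exp (-ε) / 2)
        ≤ F p₀ p₁ (Real.exp ε * (1 - q)) q) := by
  have hlt : ∀ q : ℝ, q ≤ 1 - Real.exp (-ε) / 2 → q < 1 := fun q hq => by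
    linarith [Real.exp_pos (-ε)]
  have hc : 1 ≤ Real.exp ε := Real.one_le_exp hε.le
  exact ⟨fun q _ hq => F_mul_one_sub p₀ p₁ _ (hlt q hq),
    fun q q' hq _ _ hq' hqq' => F_mul_one_sub_antitone h₀ h₁ hc hq hqq' (hlt q' hq'),
    fun q hq hq' => F_mul_one_sub_antitone h₀ h₁ hc hq hq' (hlt _ le_rfl)⟩
end

section
/- Let ε > 0 and let p_0, p_1 be real numbers with p_0 > 0 and p_1 > 0. Define F(p, q) = (pq − (1−p)(1−q)) / ((p_0(1−p) + p_1 q)(p_0 p + p_1(1−q))). Then F(1/2, 1 − e^{−ε}/2) ≤ F(1 − e^{−ε}/2, 1/2) if and only if p_1 ≤ p_0. -/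
/-- Final case comparison in the proof of Theorem 1: the minimizer of the boundary
piece `p = e^ε(1−q)` beats the minimizer of the boundary piece `q = e^ε(1−p)` exactly
when `p₁ ≤ p₀`. -/
theorem case_comparison
    (ε p₀ p₁ : ℝ) (hε : 0 < ε) (h₀ : 0 < p₀) (h₁ : 0 < p₁) :
    F p₀ p₁ (1 / 2) (1 - Real.exp (-ε) / 2)
        ≤ F p₀ p₁ (1 - Real.exp (-ε) / 2) (1 / 2)
      ↔ p₁ ≤ p₀ := by
  have ht₀ : 0 < Real.exp (-ε) / 2 := by positivity
  have ht₁ : Real.exp (-ε) / 2 < 1 / 2 := by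
    have := Real.exp_lt_one_iff.mpr (neg_lt_zero.mpr hε)
    linarith
  generalize Real.exp (-ε) / 2 = t at ht₀ ht₁ ⊢
  have ht₂ : 0 < 1 - t := by linarith
  have hN : 0 < 1 / 2 - t := by linarith
  have hF₀ : F p₀ p₁ (1 / 2) (1 - t) =
      (1 / 2 - t) / ((p₀ / 2 + p₁ * (1 - t)) * (p₀ / 2 + p₁ * t)) := by
    unfold F
    congr 1 <;> ring
  have hF₁ : F p₀ p₁ (1 - t) (1 / 2) =
      (1 / 2 - t) / ((p₀ * t + p₁ / 2) * (p₀ * (1 - t) + p₁ / 2)) := by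
    unfold F
    congr 1 <;> ring
  have hdiff : (p₀ / 2 + p₁ * (1 - t)) * (p₀ / 2 + p₁ * t)
      - (p₀ * t + p₁ / 2) * (p₀ * (1 - t) + p₁ / 2)
      = (p₀ + p₁) * (1 / 2 - t) ^ 2 * (p₀ - p₁) := by
    ring
  rw [hF₀, hF₁, div_le_div_iff_of_pos_left hN (by positivity) (by positivity),
    ← sub_nonneg, hdiff, mul_nonneg_iff_of_pos_left (by positivity), sub_nonneg]
end
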